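/- Let G be a polyunsaturated SGK graph with clique number c, and set b_k = Δα_k(G) for k = 1, …, c. Then b_2 > b_3 > … > b_{c-1}; that is, the sequence Δα_k(G) is strictly decreasing for 2 ≤ k ≤ c-1. -/

import Mathlib

/-- `s` is an independent set of the graph `G`. -/
def IndepSet {V : Type*} (G : SimpleGraph V) (s : Set V) : Prop :=
  ∀ ⦃v⦄, v ∈ s → ∀ ⦃w⦄, w ∈ s → ¬ G.Adj v w

/-- `α_k(G)`: the maximum number of vertices in a union of `k` independent sets. -/
noncomputable def alphak {V : Type*} (G : SimpleGraph V) (k : ℕ) : ℕ :=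
  sSup {n | ∃ A : Fin k → Set V, (∀ i, IndepSet G (A i)) ∧ (⋃ i, A i).ncard = n}

/-- `ω_k(G)`: the maximum number of vertices in a union of `k` cliques. -/
noncomputable def omegak {V : Type*} (G : SimpleGraph V) (k : ℕ) : ℕ :=
  sSup {n | ∃ A : Fin k → Set V, (∀ i, G.IsClique (A i)) ∧ (⋃ i, A i).ncard = n}

/-- The clique number `ω(G)`. -/
noncomputable def cliqueNumber {V : Type*} (G : SimpleGraph V) : ℕ :=
  sSup {n | ∃ s : Set V, G.IsClique s ∧ s.ncard = n}

/-- The independence number `α(G)`. -/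
noncomputable def indepNumber {V : Type*} (G : SimpleGraph V) : ℕ :=
  sSup {n | ∃ s : Set V, IndepSet G s ∧ s.ncard = n}

/-- `f` encodes a partition of the vertices of `G` into cliques:
its (nonempty) fibers are the cliques. -/
def IsCliquePartition {V : Type*} (G : SimpleGraph V) (f : V → V) : Prop :=
  ∀ i : V, G.IsClique (f ⁻¹' {i})

/-- The `k`-norm of the partition encoded by `f`: `Σ_C min (k, |C|)`. -/
noncomputable def knorm {V : Type*} [Fintype V] (f : V → V) (k : ℕ) : ℕ :=
  ∑ i : V, min k (f ⁻¹' {i}).ncard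

/-- `G` is a strong Greene–Kleitman (SGK) graph: every induced subgraph has, for every
positive `k`, a clique partition that is simultaneously `k`- and `k+1`-saturated. -/
def SGK {V : Type*} [Fintype V] (G : SimpleGraph V) : Prop :=
  ∀ (s : Finset V) (k : ℕ), 0 < k →
    ∃ f : (↑s : Set V) → (↑s : Set V),
      IsCliquePartition (G.induce ↑s) f ∧
      knorm f k = alphak (G.induce ↑s) k ∧
      knorm f (k + 1) = alphak (G.induce ↑s) (k + 1)

/-- An SGK graph is polyunsaturated if no clique partition is simultaneously `k`- and
`l`-saturated for distinct nonconsecutive positive `k, l` below the clique number. -/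
def PolyunsatG {V : Type*} [Fintype V] (G : SimpleGraph V) : Prop :=
  ∀ k l : ℕ, 0 < k → 0 < l → k < cliqueNumber G → l < cliqueNumber G →
    (k + 2 ≤ l ∨ l + 2 ≤ k) →
    ¬ ∃ f : V → V, IsCliquePartition G f ∧ knorm f k = alphak G k ∧ knorm f l = alphak G l

/-- `G` is a comparability graph: adjacency is comparability in some partial order. -/
def IsComparabilityGraph {V : Type*} (G : SimpleGraph V) : Prop :=
  ∃ r : V → V → Prop, IsPartialOrder V r ∧ ∀ v w, G.Adj v w ↔ (v ≠ w ∧ (r v w ∨ r w v))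

theorem card_iUnion_indepSet_le_knorm {V : Type*} [Fintype V] {G : SimpleGraph V} {f : V → V}
    (hf : IsCliquePartition G f) {k : ℕ} {A : Fin k → Set V} (hA : ∀ i, IndepSet G (A i)) :
    (⋃ i, A i).ncard ≤ knorm f k := by
  classical
  have hcover : (⋃ i, A i) = ⋃ v ∈ (Finset.univ : Finset V), (⋃ i, A i) ∩ f ⁻¹' {v} := by
    ext x; simp
  rw [hcover]
  refine (Finset.set_ncard_biUnion_le _ _).trans (Finset.sum_le_sum fun v _ => le_min ?_ ?_)
  · have hv : (⋃ i, A i) ∩ f ⁻¹' {v}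
        = ⋃ i ∈ (Finset.univ : Finset (Fin k)), A i ∩ f ⁻¹' {v} := by
      ext x; simp
    rw [hv]
    refine (Finset.set_ncard_biUnion_le _ _).trans
      ((Finset.sum_le_card_nsmul _ _ 1 fun i _ => ?_).trans (by simp))
    refine (Set.ncard_le_one (Set.toFinite _)).2 fun a ha b hb => ?_
    by_contra hab
    exact hA i ha.1 hb.1 (hf v ha.2 hb.2 hab)
  · exact Set.ncard_le_ncard Set.inter_subset_right (Set.toFinite _)

theorem alphak_le_knorm {V : Type*} [Fintype V] {G : SimpleGraph V} {f : V → V}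
    (hf : IsCliquePartition G f) (k : ℕ) : alphak G k ≤ knorm f k := by
  refine csSup_le ⟨_, fun _ => ∅, fun _ _ h => h.elim, rfl⟩ ?_
  rintro n ⟨A, hA, rfl⟩
  exact card_iUnion_indepSet_le_knorm hf hA

theorem exists_indepSets_of_iso {V W : Type*} {G : SimpleGraph V} {H : SimpleGraph W}
    (e : G ≃g H) {k n : ℕ}
    (h : ∃ A : Fin k → Set V, (∀ i, IndepSet G (A i)) ∧ (⋃ i, A i).ncard = n) :
    ∃ A : Fin k → Set W, (∀ i, IndepSet H (A i)) ∧ (⋃ i, A i).ncard = n := by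
  obtain ⟨A, hA, rfl⟩ := h
  refine ⟨fun i => e '' A i, ?_, ?_⟩
  · rintro i _ ⟨v, hv, rfl⟩ _ ⟨w, hw, rfl⟩ hvw
    exact hA i hv hw (e.map_adj_iff.1 hvw)
  · rw [← Set.image_iUnion, Set.ncard_image_of_injective _ e.injective]

theorem alphak_congr {V W : Type*} {G : SimpleGraph V} {H : SimpleGraph W}
    (e : G ≃g H) (k : ℕ) : alphak G k = alphak H k :=
  congrArg sSup <| Set.ext fun _ =>
    ⟨exists_indepSets_of_iso e, exists_indepSets_of_iso e.symm⟩

theorem preimage_conj_singleton {V W : Type*} (e : V ≃ W) (f : V → V) (w : W) :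
    (fun x => e (f (e.symm x))) ⁻¹' {w} = e '' (f ⁻¹' {e.symm w}) := by
  ext x
  simp [Equiv.image_eq_preimage_symm, Equiv.eq_symm_apply]

theorem IsCliquePartition.conj {V W : Type*} {G : SimpleGraph V} {H : SimpleGraph W}
    (e : G ≃g H) {f : V → V} (hf : IsCliquePartition G f) :
    IsCliquePartition H (fun x => e (f (e.symm x))) := by
  intro w a ha b hb hab
  refine e.symm.map_adj_iff.1 (hf (e.symm w) ?_ ?_ (e.symm.injective.ne hab))
  · simpa using congrArg e.symm ha
  · simpa using congrArg e.symm hb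

theorem knorm_conj {V W : Type*} [Fintype V] [Fintype W] (e : V ≃ W) (f : V → V) (k : ℕ) :
    knorm (fun x => e (f (e.symm x))) k = knorm f k := by
  refine Fintype.sum_equiv e.symm _ _ fun w => ?_
  rw [preimage_conj_singleton, Set.ncard_image_of_injective _ e.injective]

/-- An SGK graph itself has simultaneously `k`- and `k+1`-saturated clique partitions. -/
theorem SGK.exists_saturated {V : Type*} [Fintype V] {G : SimpleGraph V} (hG : SGK G) {k : ℕ}
    (hk : 0 < k) :
    ∃ f : V → V, IsCliquePartition G f ∧ knorm f k = alphak G k ∧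
      knorm f (k + 1) = alphak G (k + 1) := by
  obtain ⟨f, hf, h₁, h₂⟩ := hG Finset.univ k hk
  let e : G.induce (↑(Finset.univ : Finset V) : Set V) ≃g G :=
    { toEquiv := Equiv.subtypeUnivEquiv (by simp)
      map_rel_iff' := by simp }
  refine ⟨fun x => e (f (e.symm x)), hf.conj e, ?_, ?_⟩
  · rw [← alphak_congr e, ← h₁]
    exact knorm_conj e.toEquiv f k
  · rw [← alphak_congr e, ← h₂]
    exact knorm_conj e.toEquiv f (k + 1)

theorem knorm_concave {V : Type*} [Fintype V] (f : V → V) (k : ℕ) :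
    knorm f (k + 2) + knorm f k ≤ 2 * knorm f (k + 1) := by
  simp only [knorm, ← Finset.sum_add_distrib, Finset.mul_sum]
  exact Finset.sum_le_sum fun v _ => by omega

/-- If `G` is a polyunsaturated SGK graph with clique number `c`, then the sequence
`Δα_k(G)` is strictly decreasing for `2 ≤ k ≤ c - 1` (stated additively). -/
theorem statement9 {V : Type*} [Fintype V] (G : SimpleGraph V) (c : ℕ)
    (hSGK : SGK G) (hc : cliqueNumber G = c) (hpoly : PolyunsatG G) :
    ∀ k : ℕ, 2 ≤ k → k + 2 ≤ c →
      alphak G (k + 1) + alphak G (k - 1) < 2 * alphak G k := by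
  intro k hk hkc
  obtain ⟨m, rfl⟩ : ∃ m, k = m + 1 := ⟨k - 1, by omega⟩
  obtain ⟨f, hf, h₁, h₂⟩ := hSGK.exists_saturated (k := m) (by omega)
  have hle := alphak_le_knorm hf (m + 2)
  have hne : knorm f (m + 2) ≠ alphak G (m + 2) := fun h =>
    hpoly m (m + 2) (by omega) (by omega) (by omega) (by omega) (.inl le_rfl) ⟨f, hf, h₁, h⟩
  have hconc := knorm_concave f m
  rw [Nat.add_sub_cancel]
  change alphak G (m + 2) + _ < _
  omega
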